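/- Let $f:\mathbb{R}\to\mathbb{R}$ be bounded and uniformly continuous, and define the Maxwell–Boltzmann convolution operator $S_t(f)(x) = \frac{1}{\sqrt{2\pi}} \int_{-\infty}^{+\infty} f(x-v) \cdot \frac{v^2 e^{-v^2/(2t^2)}}{t^3}\, dv$ for $t>0$, $x \in \mathbb{R}$. Then $|S_t(f)(x) - f(x)| \le 4\,\omega_1(f; t)$ for all $t>0$ and $x \in \mathbb{R}$. -/

import Mathlib

open MeasureTheory Filter

/-- The modulus of continuity `ω₁(f; δ) = sup {|f x - f y| : |x - y| ≤ δ}`. -/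
noncomputable def omega1 (f : ℝ → ℝ) (δ : ℝ) : ℝ :=
  sSup {d : ℝ | ∃ x y : ℝ, |x - y| ≤ δ ∧ d = |f x - f y|}

/-- The Maxwell–Boltzmann convolution operator. -/
noncomputable def maxwellConv (f : ℝ → ℝ) (t x : ℝ) : ℝ :=
  (1 / Real.sqrt (2 * Real.pi)) *
    ∫ v : ℝ, f (x - v) * (v ^ 2 * Real.exp (-v ^ 2 / (2 * t ^ 2)) / t ^ 3)

lemma mb_J (b : ℝ) (hb : 0 < b) (n : ℕ) (hn : Even n) :
    ∫ x : ℝ, x ^ n * Real.exp (-b * x ^ 2) =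
      2 * (b ^ (-((n : ℝ) + 1) / 2) * (1 / 2) * Real.Gamma (((n : ℝ) + 1) / 2)) := by
  have h := integral_rpow_mul_exp_neg_mul_rpow (p := 2) (q := n) (b := b) two_pos
    (by have : (0 : ℝ) ≤ n := Nat.cast_nonneg n
        linarith) hb
  rw [← h]
  have h2 := integral_comp_abs (f := fun x : ℝ => x ^ n * Real.exp (-b * x ^ 2))
  simp only [hn.pow_abs, sq_abs] at h2
  rw [h2]
  simp only [Real.rpow_natCast, Real.rpow_two]

lemma mb_rec (b : ℝ) (hb : 0 < b) (n : ℕ) (hn : Even n) :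
    ∫ x : ℝ, x ^ (n + 2) * Real.exp (-b * x ^ 2) =
      ((n : ℝ) + 1) / (2 * b) * ∫ x : ℝ, x ^ n * Real.exp (-b * x ^ 2) := by
  rw [mb_J b hb n hn, mb_J b hb (n + 2) (hn.add even_two)]
  have e1 : (((n + 2 : ℕ) : ℝ) + 1) / 2 = ((n : ℝ) + 1) / 2 + 1 := by push_cast; ring
  have e2 : -(((n + 2 : ℕ) : ℝ) + 1) / 2 = -((n : ℝ) + 1) / 2 - 1 := by push_cast; ring
  have hpos : ((n : ℝ) + 1) / 2 ≠ 0 := by positivity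
  rw [e1, e2, Real.Gamma_add_one hpos, Real.rpow_sub_one hb.ne']
  field_simp

lemma mb_int (b : ℝ) (hb : 0 < b) (n : ℕ) :
    Integrable (fun x : ℝ => x ^ n * Real.exp (-b * x ^ 2)) := by
  have h := integrable_rpow_mul_exp_neg_mul_sq hb (s := n)
    (by have : (0 : ℝ) ≤ n := Nat.cast_nonneg n
        linarith)
  simpa only [Real.rpow_natCast] using h

lemma mb_omega (f : ℝ → ℝ) (hf_bdd : ∃ M : ℝ, ∀ x : ℝ, |f x| ≤ M) (t : ℝ)
    (x y : ℝ) (h : |x - y| ≤ t) : |f x - f y| ≤ omega1 f t := by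
  obtain ⟨M, hM⟩ := hf_bdd
  apply le_csSup
  · refine ⟨M + M, ?_⟩
    rintro d ⟨a, c, -, rfl⟩
    exact (abs_sub _ _).trans (add_le_add (hM a) (hM c))
  · exact ⟨x, y, h, rfl⟩

lemma mb_steps (f : ℝ → ℝ) (hf_bdd : ∃ M : ℝ, ∀ x : ℝ, |f x| ≤ M) (t : ℝ)
    (x w : ℝ) (hw : |w| ≤ t) (n : ℕ) : |f (x - n * w) - f x| ≤ n * omega1 f t := by
  induction n with
  | zero => simp
  | succ k ih =>
    have h1 := mb_omega f hf_bdd t (x - (k + 1 : ℕ) * w) (x - k * w) (by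
      have : x - (k + 1 : ℕ) * w - (x - k * w) = -w := by push_cast; ring
      rw [this, abs_neg]; exact hw)
    have h2 := abs_sub_le (f (x - (k + 1 : ℕ) * w)) (f (x - k * w)) (f x)
    push_cast at *
    linarith

lemma mb_ptw (f : ℝ → ℝ) (hf_bdd : ∃ M : ℝ, ∀ x : ℝ, |f x| ≤ M) (t : ℝ) (ht : 0 < t)
    (x v : ℝ) : |f (x - v) - f x| ≤ (3 / 2 + v ^ 2 / (2 * t ^ 2)) * omega1 f t := by
  have h0 : 0 ≤ omega1 f t :=
    (abs_nonneg _).trans (mb_omega f hf_bdd t x x (by simpa using ht.le))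
  set n := ⌊|v| / t⌋₊ + 1 with hn
  have hnpos : (0 : ℝ) < n := by rw [hn]; positivity
  have h1 : |v| / t < n := by rw [hn]; exact_mod_cast Nat.lt_floor_add_one (|v| / t)
  have h2 : (n : ℝ) ≤ |v| / t + 1 := by
    rw [hn]; push_cast
    have := Nat.floor_le (a := |v| / t) (by positivity)
    linarith
  have h3 := mb_steps f hf_bdd t x (v / n) (by
    rw [abs_div, abs_of_pos hnpos, div_le_iff₀ hnpos]
    rw [div_lt_iff₀ ht] at h1
    linarith) n
  rw [mul_div_cancel₀ _ hnpos.ne'] at h3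
  refine h3.trans (mul_le_mul_of_nonneg_right ?_ h0)
  have h4 : v ^ 2 / (2 * t ^ 2) = (|v| / t) ^ 2 / 2 := by
    rw [div_pow, sq_abs]; field_simp
  rw [h4]
  nlinarith [sq_nonneg (|v| / t - 1)]

theorem maxwell_boltzmann_approx
    (f : ℝ → ℝ)
    (hf_bdd : ∃ M : ℝ, ∀ x : ℝ, |f x| ≤ M)
    (hf_uc : UniformContinuous f) :
    ∀ t > (0 : ℝ), ∀ x : ℝ, |maxwellConv f t x - f x| ≤ 4 * omega1 f t := by
  intro t ht x
  have h0 : 0 ≤ omega1 f t :=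
    (abs_nonneg _).trans (mb_omega f hf_bdd t x x (by simpa using ht.le))
  set b : ℝ := 1 / (2 * t ^ 2) with hb
  have hbpos : 0 < b := by positivity
  set s := Real.sqrt (2 * Real.pi) with hs
  have hspos : 0 < s := Real.sqrt_pos.2 (by positivity)
  have I0 : ∫ v : ℝ, v ^ 0 * Real.exp (-b * v ^ 2) = t * s := by
    simp only [pow_zero, one_mul]
    rw [integral_gaussian, hs]
    have : Real.pi / b = t ^ 2 * (2 * Real.pi) := by rw [hb]; field_simp
    rw [this, Real.sqrt_mul (by positivity), Real.sqrt_sq ht.le]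
  have I2 : ∫ v : ℝ, v ^ 2 * Real.exp (-b * v ^ 2) = t ^ 3 * s := by
    have := mb_rec b hbpos 0 (by simp)
    rw [I0] at this
    simp only [zero_add] at this
    rw [this, hb]; push_cast; field_simp; try norm_num
  have I4 : ∫ v : ℝ, v ^ 4 * Real.exp (-b * v ^ 2) = 3 * t ^ 5 * s := by
    have := mb_rec b hbpos 2 (by simp)
    rw [I2] at this
    norm_num at this
    norm_num
    rw [this, hb]; field_simp; try norm_num
  let g : ℝ → ℝ := fun v => v ^ 2 * Real.exp (-v ^ 2 / (2 * t ^ 2)) / t ^ 3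
  have hg : ∀ v, g v = (1 / t ^ 3) * (v ^ 2 * Real.exp (-b * v ^ 2)) := by
    intro v
    have : -v ^ 2 / (2 * t ^ 2) = -b * v ^ 2 := by rw [hb]; ring
    simp only [g, this]; ring
  have hg0 : ∀ v, 0 ≤ g v := fun v => by simp only [g]; positivity
  have hgi : Integrable g := by
    rw [funext hg]; exact (mb_int b hbpos 2).const_mul _
  have Ig : ∫ v, g v = s := by
    simp only [hg]; rw [integral_const_mul, I2]; field_simp
  obtain ⟨M, hM⟩ := id hf_bdd
  have hfi : Integrable (fun v => f (x - v) * g v) := by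
    refine hgi.bdd_mul (c := M) ?_ ?_
    · exact (hf_uc.continuous.comp (by fun_prop)).aestronglyMeasurable
    · exact Eventually.of_forall fun v => by simpa using hM (x - v)
  have key : maxwellConv f t x - f x = (1 / s) * ∫ v, (f (x - v) - f x) * g v := by
    have : ∫ v, (f (x - v) - f x) * g v = (∫ v, f (x - v) * g v) - f x * s := by
      simp only [sub_mul]
      rw [integral_sub hfi (hgi.const_mul _), integral_const_mul, Ig]
    rw [this]
    have h5 : maxwellConv f t x = (1 / s) * ∫ v, f (x - v) * g v := rfl
    rw [h5]
    generalize (∫ v, f (x - v) * g v) = A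
    field_simp
  let G : ℝ → ℝ := fun v => (omega1 f t) * (3 / 2 * g v +
    (1 / (2 * t ^ 5)) * (v ^ 4 * Real.exp (-b * v ^ 2)))
  have hi4 := (mb_int b hbpos 4).const_mul (1 / (2 * t ^ 5))
  have hGi : Integrable G := ((hgi.const_mul (3 / 2)).add hi4).const_mul _
  have IG : ∫ v, G v = 3 * s * omega1 f t := by
    simp only [G]
    rw [integral_const_mul, integral_add (hgi.const_mul _) hi4, integral_const_mul,
      integral_const_mul, Ig, I4]
    field_simp; ring
  have hbound : ‖∫ v, (f (x - v) - f x) * g v‖ ≤ ∫ v, G v := by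
    refine norm_integral_le_of_norm_le hGi (Eventually.of_forall fun v => ?_)
    rw [Real.norm_eq_abs, abs_mul, abs_of_nonneg (hg0 v)]
    refine (mul_le_mul_of_nonneg_right (mb_ptw f hf_bdd t ht x v) (hg0 v)).trans_eq ?_
    simp only [G, hg]
    field_simp
  rw [key, abs_mul, abs_of_pos (by positivity : 0 < 1 / s)]
  rw [IG, Real.norm_eq_abs] at hbound
  calc _ ≤ (1 / s) * (3 * s * omega1 f t) := by gcongr
    _ = 3 * omega1 f t := by field_simp
    _ ≤ _ := by linarith
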